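/- arXiv:1704.04709 — 4 statements merged into one kernel-verified Lean document; each statement's English description precedes it below -/
import Mathlib

section
/- (Proposition 1.) Let σ > 0. The function g_σ(t) := φ_σ(t)² / (Φ_σ(t)·(1 − Φ_σ(t))) is positive for every t ∈ ℝ, symmetric in the sense that g_σ(−t) = g_σ(t) for all t ∈ ℝ, satisfies g_σ(t) ≤ 2/(πσ²) for all t ∈ ℝ, and equality g_σ(t) = 2/(πσ²) holds if and only if t = 0. -/
/-- PDF of a real Gaussian with mean 0 and variance σ². -/
noncomputable def gaussPhi (σ t : ℝ) : ℝ :=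
  (Real.sqrt (2 * Real.pi * σ ^ 2))⁻¹ * Real.exp (-(t ^ 2) / (2 * σ ^ 2))

/-- CDF of a real Gaussian with mean 0 and variance σ². -/
noncomputable def gaussPhiCDF (σ t : ℝ) : ℝ := ∫ u in Set.Iic t, gaussPhi σ u

/-- g_σ(t) := φ_σ(t)² / (Φ_σ(t)·(1 − Φ_σ(t))). -/
noncomputable def gFun (σ t : ℝ) : ℝ :=
  (gaussPhi σ t) ^ 2 / (gaussPhiCDF σ t * (1 - gaussPhiCDF σ t))

open Set Filter Topology MeasureTheory

lemma gaussPhi_eq_gaussianPDFReal (σ : ℝ) :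
    gaussPhi σ = ProbabilityTheory.gaussianPDFReal 0 ⟨σ ^ 2, sq_nonneg σ⟩ := by
  ext t
  simp only [gaussPhi, ProbabilityTheory.gaussianPDFReal, sub_zero]
  rfl

lemma gaussPhi_pos {σ : ℝ} (hσ : 0 < σ) (t : ℝ) : 0 < gaussPhi σ t := by
  unfold gaussPhi
  positivity

lemma gaussPhi_neg (σ t : ℝ) : gaussPhi σ (-t) = gaussPhi σ t := by
  simp [gaussPhi]

lemma integrable_gaussPhi (σ : ℝ) : Integrable (gaussPhi σ) := by
  rw [gaussPhi_eq_gaussianPDFReal]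
  exact ProbabilityTheory.integrable_gaussianPDFReal _ _

lemma integral_gaussPhi {σ : ℝ} (hσ : 0 < σ) : ∫ t, gaussPhi σ t = 1 := by
  rw [gaussPhi_eq_gaussianPDFReal]
  refine ProbabilityTheory.integral_gaussianPDFReal_eq_one _ fun h => ?_
  exact (pow_pos hσ 2).ne' (congrArg NNReal.toReal h)

lemma continuous_gaussPhi (σ : ℝ) : Continuous (gaussPhi σ) := by
  unfold gaussPhi
  fun_prop

lemma hasDerivAt_gaussPhi {σ : ℝ} (hσ : 0 < σ) (t : ℝ) :
    HasDerivAt (gaussPhi σ) (-(t / σ ^ 2) * gaussPhi σ t) t := by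
  have h := ((((hasDerivAt_id t).pow 2).neg.div_const (2 * σ ^ 2)).exp).const_mul
    (Real.sqrt (2 * Real.pi * σ ^ 2))⁻¹
  refine h.congr_deriv ?_
  simp [gaussPhi]
  field_simp

lemma gaussPhi_zero_sq {σ : ℝ} (hσ : 0 < σ) :
    2 * Real.pi * σ ^ 2 * gaussPhi σ 0 ^ 2 = 1 := by
  have h : 0 < 2 * Real.pi * σ ^ 2 := by positivity
  simp only [gaussPhi, mul_pow, inv_pow, Real.sq_sqrt h.le]
  simp
  field_simp

lemma tendsto_gaussPhi_atTop {σ : ℝ} (hσ : 0 < σ) : Tendsto (gaussPhi σ) atTop (𝓝 0) := by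
  have h : Tendsto (fun t : ℝ => -(t ^ 2) / (2 * σ ^ 2)) atTop atBot :=
    (tendsto_neg_atTop_atBot.comp (tendsto_pow_atTop two_ne_zero)).atBot_div_const (by positivity)
  unfold gaussPhi
  simpa using
    (Real.tendsto_exp_atBot.comp h).const_mul (Real.sqrt (2 * Real.pi * σ ^ 2))⁻¹

lemma gaussPhiCDF_neg {σ : ℝ} (hσ : 0 < σ) (t : ℝ) :
    gaussPhiCDF σ (-t) = 1 - gaussPhiCDF σ t := by
  have h₁ : gaussPhiCDF σ (-t) = ∫ u in Ioi t, gaussPhi σ u := by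
    simpa [gaussPhi_neg, gaussPhiCDF] using integral_comp_neg_Iic (-t) (gaussPhi σ)
  have h₂ := intervalIntegral.integral_Iic_add_Ioi (b := t)
    (integrable_gaussPhi σ).integrableOn (integrable_gaussPhi σ).integrableOn
  rw [integral_gaussPhi hσ] at h₂
  rw [h₁, gaussPhiCDF]
  linarith

lemma gaussPhiCDF_zero {σ : ℝ} (hσ : 0 < σ) : gaussPhiCDF σ 0 = 1 / 2 := by
  have h := gaussPhiCDF_neg hσ 0
  rw [neg_zero] at h
  linarith

lemma gaussPhiCDF_pos {σ : ℝ} (hσ : 0 < σ) (t : ℝ) : 0 < gaussPhiCDF σ t := by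
  refine (setIntegral_pos_iff_support_of_nonneg_ae
    (ae_of_all _ fun u => (gaussPhi_pos hσ u).le) (integrable_gaussPhi σ).integrableOn).2 ?_
  have h : Function.support (gaussPhi σ) = univ :=
    Function.support_eq_univ fun u => (gaussPhi_pos hσ u).ne'
  simp [h]

lemma gaussPhiCDF_lt_one {σ : ℝ} (hσ : 0 < σ) (t : ℝ) : gaussPhiCDF σ t < 1 := by
  have h := gaussPhiCDF_pos hσ (-t)
  rw [gaussPhiCDF_neg hσ] at h
  linarith

lemma hasDerivAt_gaussPhiCDF (σ t : ℝ) : HasDerivAt (gaussPhiCDF σ) (gaussPhi σ t) t := by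
  have h : gaussPhiCDF σ = fun s => gaussPhiCDF σ 0 + ∫ u in (0 : ℝ)..s, gaussPhi σ u := by
    ext s
    rw [← intervalIntegral.integral_Iic_sub_Iic (integrable_gaussPhi σ).integrableOn
      (integrable_gaussPhi σ).integrableOn]
    simp [gaussPhiCDF]
  rw [h]
  exact (intervalIntegral.integral_hasDerivAt_right
    ((continuous_gaussPhi σ).intervalIntegrable _ _)
    ((continuous_gaussPhi σ).stronglyMeasurableAtFilter _ _)
    (continuous_gaussPhi σ).continuousAt).const_add _

lemma tendsto_gaussPhiCDF_atTop {σ : ℝ} (hσ : 0 < σ) :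
    Tendsto (gaussPhiCDF σ) atTop (𝓝 1) := by
  rw [← integral_gaussPhi hσ]
  exact (aecover_Iic tendsto_id).integral_tendsto_of_countably_generated (integrable_gaussPhi σ)

/-- Up to the positive factor `4 * gaussPhi σ t`, the derivative of
`4 * Φ * (1 - Φ) - 2 * π * σ ^ 2 * φ ^ 2`. -/
noncomputable def gaussGapSlope (σ t : ℝ) : ℝ :=
  1 - 2 * gaussPhiCDF σ t + Real.pi * t * gaussPhi σ t

lemma hasDerivAt_gaussGapSlope {σ : ℝ} (hσ : 0 < σ) (t : ℝ) :
    HasDerivAt (gaussGapSlope σ)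
      (gaussPhi σ t * (Real.pi - 2 - Real.pi * (t / σ) ^ 2)) t := by
  have h := (((hasDerivAt_gaussPhiCDF σ t).const_mul 2).const_sub 1).add
    (((hasDerivAt_id t).const_mul Real.pi).mul (hasDerivAt_gaussPhi hσ t))
  refine h.congr_deriv ?_
  simp
  field_simp
  ring

/-- The slope is positive until it first vanishes, and negative from then on. -/
lemma gaussGapSlope_sign {σ : ℝ} (hσ : 0 < σ) {s t : ℝ} (hs : 0 < s) (hst : s < t)
    (h : gaussGapSlope σ s ≤ 0) : gaussGapSlope σ t < 0 := by
  have hcont : Continuous (gaussGapSlope σ) :=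
    continuous_iff_continuousAt.2 fun u => (hasDerivAt_gaussGapSlope hσ u).continuousAt
  have hzero : gaussGapSlope σ 0 = 0 := by
    simp [gaussGapSlope, gaussPhiCDF_zero hσ]
  have hs' : Real.pi - 2 - Real.pi * (s / σ) ^ 2 < 0 := by
    by_contra! hneg
    have hmono : StrictMonoOn (gaussGapSlope σ) (Icc 0 s) := by
      refine strictMonoOn_of_deriv_pos (convex_Icc 0 s) hcont.continuousOn fun u hu => ?_
      rw [interior_Icc] at hu
      rw [(hasDerivAt_gaussGapSlope hσ u).deriv]
      refine mul_pos (gaussPhi_pos hσ u) ?_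
      have hlt : (u / σ) ^ 2 < (s / σ) ^ 2 := by
        have := hu.1
        have := hu.2
        gcongr
      nlinarith [Real.pi_pos]
    have := hmono (left_mem_Icc.2 hs.le) (right_mem_Icc.2 hs.le) hs
    linarith
  have hanti : StrictAntiOn (gaussGapSlope σ) (Ici s) := by
    refine strictAntiOn_of_deriv_neg (convex_Ici s) hcont.continuousOn fun u hu => ?_
    rw [interior_Ici] at hu
    rw [(hasDerivAt_gaussGapSlope hσ u).deriv]
    refine mul_neg_of_pos_of_neg (gaussPhi_pos hσ u) ?_
    have hlt : (s / σ) ^ 2 < (u / σ) ^ 2 := by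
      have : s < u := hu
      gcongr
    nlinarith [Real.pi_pos]
  exact (hanti self_mem_Ici hst.le hst).trans_le h

lemma two_pi_mul_gaussPhi_sq_lt_of_pos {σ : ℝ} (hσ : 0 < σ) {t : ℝ} (ht : 0 < t) :
    2 * Real.pi * σ ^ 2 * gaussPhi σ t ^ 2 < 4 * (gaussPhiCDF σ t * (1 - gaussPhiCDF σ t)) := by
  set F : ℝ → ℝ := fun t =>
    4 * (gaussPhiCDF σ t * (1 - gaussPhiCDF σ t)) - 2 * Real.pi * σ ^ 2 * gaussPhi σ t ^ 2 with hF
  have hderiv (u : ℝ) : HasDerivAt F (4 * gaussPhi σ u * gaussGapSlope σ u) u := by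
    have h := hasDerivAt_gaussPhiCDF σ u
    refine (((h.mul (h.const_sub 1)).const_mul 4).sub
      (((hasDerivAt_gaussPhi hσ u).pow 2).const_mul (2 * Real.pi * σ ^ 2))).congr_deriv ?_
    simp [gaussGapSlope]
    field_simp
    ring
  have hcont : Continuous F := continuous_iff_continuousAt.2 fun u => (hderiv u).continuousAt
  have hzero : F 0 = 0 := by
    simp only [hF, gaussPhi_zero_sq hσ, gaussPhiCDF_zero hσ]
    norm_num
  have hlim : Tendsto F atTop (𝓝 0) := by
    have h := tendsto_gaussPhiCDF_atTop hσ
    have := ((h.mul (h.const_sub 1)).const_mul 4).sub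
      (((tendsto_gaussPhi_atTop hσ).pow 2).const_mul (2 * Real.pi * σ ^ 2))
    simpa using this
  suffices 0 < F t from sub_pos.1 this
  rcases le_or_gt (gaussGapSlope σ t) 0 with hslope | hslope
  · have hanti : StrictAntiOn F (Ici t) := by
      refine strictAntiOn_of_deriv_neg (convex_Ici t) hcont.continuousOn fun u hu => ?_
      rw [interior_Ici] at hu
      rw [(hderiv u).deriv]
      exact mul_neg_of_pos_of_neg (mul_pos four_pos (gaussPhi_pos hσ u))
        (gaussGapSlope_sign hσ ht hu hslope)
    have hmem : t + 1 ∈ Ici t := by simp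
    have hle : 0 ≤ F (t + 1) := le_of_tendsto hlim <| by
      filter_upwards [eventually_ge_atTop (t + 1)] with u hu
      exact hanti.antitoneOn hmem (hmem.trans hu) hu
    exact hle.trans_lt (hanti self_mem_Ici hmem (lt_add_one t))
  · have hmono : StrictMonoOn F (Icc 0 t) := by
      refine strictMonoOn_of_deriv_pos (convex_Icc 0 t) hcont.continuousOn fun u hu => ?_
      rw [interior_Icc] at hu
      rw [(hderiv u).deriv]
      refine mul_pos (mul_pos four_pos (gaussPhi_pos hσ u)) ?_
      by_contra! hu'
      exact (gaussGapSlope_sign hσ hu.1 hu.2 hu').not_gt hslope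
    exact hzero ▸ hmono (left_mem_Icc.2 ht.le) (right_mem_Icc.2 ht.le) ht

lemma gFun_neg {σ : ℝ} (hσ : 0 < σ) (t : ℝ) : gFun σ (-t) = gFun σ t := by
  rw [gFun, gFun, gaussPhi_neg, gaussPhiCDF_neg hσ, sub_sub_cancel, mul_comm (1 - _)]

lemma gFun_zero {σ : ℝ} (hσ : 0 < σ) : gFun σ 0 = 2 / (Real.pi * σ ^ 2) := by
  have h := gaussPhi_zero_sq hσ
  rw [gFun, gaussPhiCDF_zero hσ, div_eq_div_iff (by norm_num) (by positivity)]
  linarith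

lemma gFun_lt_of_pos {σ : ℝ} (hσ : 0 < σ) {t : ℝ} (ht : 0 < t) :
    gFun σ t < 2 / (Real.pi * σ ^ 2) := by
  have h := two_pi_mul_gaussPhi_sq_lt_of_pos hσ ht
  rw [gFun, div_lt_div_iff₀ (mul_pos (gaussPhiCDF_pos hσ t)
    (sub_pos.2 (gaussPhiCDF_lt_one hσ t))) (by positivity)]
  linarith

lemma gFun_lt_of_ne_zero {σ : ℝ} (hσ : 0 < σ) {t : ℝ} (ht : t ≠ 0) :
    gFun σ t < 2 / (Real.pi * σ ^ 2) := by
  rcases ht.lt_or_gt with h | h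
  · rw [← gFun_neg hσ]
    exact gFun_lt_of_pos hσ (neg_pos.2 h)
  · exact gFun_lt_of_pos hσ h

/-- Proposition 1: g_σ is positive, even, bounded by 2/(πσ²), with equality iff t = 0. -/
theorem gFun_pos_symm_max (σ : ℝ) (hσ : 0 < σ) :
    (∀ t : ℝ, 0 < gFun σ t) ∧
    (∀ t : ℝ, gFun σ (-t) = gFun σ t) ∧
    (∀ t : ℝ, gFun σ t ≤ 2 / (Real.pi * σ ^ 2)) ∧
    (∀ t : ℝ, gFun σ t = 2 / (Real.pi * σ ^ 2) ↔ t = 0) := by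
  refine ⟨fun t => ?_, gFun_neg hσ, fun t => ?_, fun t => ⟨fun h => ?_, ?_⟩⟩
  · exact div_pos (pow_pos (gaussPhi_pos hσ t) 2)
      (mul_pos (gaussPhiCDF_pos hσ t) (sub_pos.2 (gaussPhiCDF_lt_one hσ t)))
  · rcases eq_or_ne t 0 with rfl | ht
    · exact (gFun_zero hσ).le
    · exact (gFun_lt_of_ne_zero hσ ht).le
  · by_contra ht
    exact (gFun_lt_of_ne_zero hσ ht).ne h
  · rintro rfl
    exact gFun_zero hσ
end

section
/- Let φ(t) = (1/√(2π))·exp(−t²/2) and Φ(t) = ∫_{−∞}^{t} φ(u) du denote the standard normal PDF and CDF. Then for every x ∈ ℝ, φ(x)² / (Φ(x)·(1 − Φ(x))) ≤ (2/π)·exp(−(1 − 2/π)·x²). -/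
/-- Standard normal PDF. -/
noncomputable def stdPhi (t : ℝ) : ℝ :=
  (Real.sqrt (2 * Real.pi))⁻¹ * Real.exp (-(t ^ 2) / 2)

/-- Standard normal CDF. -/
noncomputable def stdPhiCDF (t : ℝ) : ℝ := ∫ u in Set.Iic t, stdPhi u

open MeasureTheory in
/-- The integral over the disc of radius `R` of a Gaussian minus a constant. -/
lemma setIntegral_disc_exp_sub_const {R : ℝ} (hR : 0 ≤ R) (c : ℝ) :
    ∫ p in {p : ℝ × ℝ | p.1 ^ 2 + p.2 ^ 2 ≤ R ^ 2},
        (Real.exp (-(p.1 ^ 2 + p.2 ^ 2) / 2) - c) =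
      2 * Real.pi * (1 - Real.exp (-(R ^ 2) / 2) - c * R ^ 2 / 2) := by
  have hmeas : MeasurableSet {p : ℝ × ℝ | p.1 ^ 2 + p.2 ^ 2 ≤ R ^ 2} :=
    measurableSet_le (by fun_prop) (by fun_prop)
  rw [← integral_indicator hmeas, ← integral_comp_polarCoord_symm]
  have hsq (p : ℝ × ℝ) :
      (p.1 * Real.cos p.2) ^ 2 + (p.1 * Real.sin p.2) ^ 2 = p.1 ^ 2 := by
    linear_combination p.1 ^ 2 * Real.sin_sq_add_cos_sq p.2
  have hcongr : ∀ p ∈ polarCoord.target,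
      p.1 • Set.indicator {p : ℝ × ℝ | p.1 ^ 2 + p.2 ^ 2 ≤ R ^ 2}
        (fun p => Real.exp (-(p.1 ^ 2 + p.2 ^ 2) / 2) - c) (polarCoord.symm p) =
      (Set.Iic R).indicator (fun r => r * (Real.exp (-(r ^ 2) / 2) - c)) p.1 * 1 := by
    rintro p ⟨hp, -⟩
    have hp : 0 < p.1 := hp
    simp only [polarCoord_symm_apply, Set.indicator_apply, Set.mem_ofPred_eq, hsq, Set.mem_Iic,
      sq_le_sq₀ hp.le hR, smul_eq_mul, mul_one]
    split_ifs <;> simp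
  rw [setIntegral_congr_fun polarCoord.open_target.measurableSet hcongr, polarCoord_target,
    Measure.volume_eq_prod,
    setIntegral_prod_mul (fun r : ℝ => (Set.Iic R).indicator
      (fun r => r * (Real.exp (-(r ^ 2) / 2) - c)) r) (fun _ : ℝ => (1 : ℝ)),
    setIntegral_indicator measurableSet_Iic, Set.Ioi_inter_Iic,
    ← intervalIntegral.integral_of_le hR]
  have hderiv : ∀ r ∈ Set.uIcc 0 R,
      HasDerivAt (fun r : ℝ => -Real.exp (-(r ^ 2) / 2) - c * r ^ 2 / 2)
        (r * (Real.exp (-(r ^ 2) / 2) - c)) r := by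
    intro r _
    have h2 : HasDerivAt (fun r : ℝ => r ^ 2) (2 * r) r := by
      simpa using hasDerivAt_pow 2 r
    refine (((h2.fun_neg.div_const 2).exp.fun_neg).fun_sub
      ((h2.const_mul c).div_const 2)).congr_deriv ?_
    ring
  rw [intervalIntegral.integral_eq_sub_of_hasDerivAt hderiv
    (Continuous.intervalIntegrable (by fun_prop) _ _)]
  have hpi := Real.pi_pos
  simp only [setIntegral_const, Real.volume_real_Ioo_of_le (by linarith : -Real.pi ≤ Real.pi)]
  norm_num
  ring

open MeasureTheory in
/-- Pólya's inequality: among planar sets of given area, the centred disc has the largest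
Gaussian measure, in particular it beats the square of half-side `x`. -/
lemma sq_integral_exp_neg_sq_le {x : ℝ} (hx : 0 ≤ x) :
    (∫ u in (-x)..x, Real.exp (-(u ^ 2) / 2)) ^ 2 ≤
      2 * Real.pi * (1 - Real.exp (-(2 / Real.pi) * x ^ 2)) := by
  have hpi := Real.pi_pos
  set R : ℝ := 2 * x / Real.sqrt Real.pi with hRdef
  have hR : 0 ≤ R := by positivity
  have hR2 : R ^ 2 = 4 * x ^ 2 / Real.pi := by
    rw [hRdef, div_pow, Real.sq_sqrt hpi.le]; ring
  set c : ℝ := Real.exp (-(R ^ 2) / 2) with hc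
  have hc' : Real.exp (-(2 / Real.pi) * x ^ 2) = c := by
    rw [hc, hR2]; congr 1; ring
  set f : ℝ × ℝ → ℝ := fun p => Real.exp (-(p.1 ^ 2 + p.2 ^ 2) / 2) - c with hf
  have hfc : Continuous f := by fun_prop
  set D : Set (ℝ × ℝ) := {p | p.1 ^ 2 + p.2 ^ 2 ≤ R ^ 2} with hD
  have hDm : MeasurableSet D := measurableSet_le (by fun_prop) (by fun_prop)
  set S : Set (ℝ × ℝ) := Set.Icc (-x) x ×ˢ Set.Icc (-x) x with hS
  have hSm : MeasurableSet S := measurableSet_Icc.prod measurableSet_Icc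
  have hSi : IntegrableOn f S :=
    hfc.continuousOn.integrableOn_compact (isCompact_Icc.prod isCompact_Icc)
  have hDi : IntegrableOn f D := by
    refine (hfc.continuousOn.integrableOn_compact
      ((isCompact_Icc (a := -R) (b := R)).prod (isCompact_Icc (a := -R) (b := R)))).mono_set ?_
    intro p hp
    have hp : p.1 ^ 2 + p.2 ^ 2 ≤ R ^ 2 := hp
    exact ⟨abs_le.1 (abs_le_of_sq_le_sq (by nlinarith [sq_nonneg p.2]) hR),
      abs_le.1 (abs_le_of_sq_le_sq (by nlinarith [sq_nonneg p.1]) hR)⟩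
  have hle : ∫ p in S, f p ≤ ∫ p in D, f p := by
    rw [← integral_indicator hSm, ← integral_indicator hDm]
    refine integral_mono (hSi.integrable_indicator hSm) (hDi.integrable_indicator hDm) ?_
    intro p
    by_cases hp : p ∈ D
    · rw [Set.indicator_of_mem hp]
      have h0 : 0 ≤ f p := by
        have hp : p.1 ^ 2 + p.2 ^ 2 ≤ R ^ 2 := hp
        exact sub_nonneg.2 (Real.exp_le_exp.2 (by linarith))
      exact Set.indicator_le' (fun _ _ => le_rfl) (fun _ _ => h0) p
    · rw [Set.indicator_of_notMem hp]
      have h0 : f p ≤ 0 := by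
        have hp : R ^ 2 < p.1 ^ 2 + p.2 ^ 2 := not_le.1 hp
        exact sub_nonpos.2 (Real.exp_le_exp.2 (by linarith))
      exact Set.indicator_le' (fun _ _ => h0) (fun _ _ => le_rfl) p
  have hSval : ∫ p in S, f p =
      (∫ u in (-x)..x, Real.exp (-(u ^ 2) / 2)) ^ 2 - 4 * x ^ 2 * c := by
    have hint : IntegrableOn (fun p : ℝ × ℝ => Real.exp (-(p.1 ^ 2 + p.2 ^ 2) / 2)) S :=
      (show Continuous _ by fun_prop).continuousOn.integrableOn_compact
        (isCompact_Icc.prod isCompact_Icc)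
    have hconst : IntegrableOn (fun _ : ℝ × ℝ => c) S :=
      continuousOn_const.integrableOn_compact (isCompact_Icc.prod isCompact_Icc)
    have hsplit (p : ℝ × ℝ) : Real.exp (-(p.1 ^ 2 + p.2 ^ 2) / 2) =
        Real.exp (-(p.1 ^ 2) / 2) * Real.exp (-(p.2 ^ 2) / 2) := by
      rw [← Real.exp_add]; congr 1; ring
    rw [hf, integral_sub hint hconst]
    congr 1
    · simp only [hsplit]
      rw [hS, Measure.volume_eq_prod,
        setIntegral_prod_mul (fun u : ℝ => Real.exp (-(u ^ 2) / 2))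
          (fun u : ℝ => Real.exp (-(u ^ 2) / 2)),
        integral_Icc_eq_integral_Ioc, ← intervalIntegral.integral_of_le (by linarith), sq]
    · rw [setIntegral_const, hS, Measure.volume_eq_prod, measureReal_prod_prod,
        Real.volume_real_Icc_of_le (by linarith), smul_eq_mul]
      ring
  have hDval := setIntegral_disc_exp_sub_const hR c
  rw [hSval, hDval, hR2] at hle
  rw [hR2] at hc
  rw [hc', ← sub_nonneg]
  have hcancel : 2 * Real.pi * (c * (4 * x ^ 2 / Real.pi) / 2) = 4 * x ^ 2 * c := by
    field_simp
  rw [← hc] at hle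
  linarith

lemma stdPhi_eq_gaussianPDFReal : stdPhi = ProbabilityTheory.gaussianPDFReal 0 1 := by
  ext t
  simp [stdPhi, ProbabilityTheory.gaussianPDFReal]

open MeasureTheory

lemma integrable_stdPhi : Integrable stdPhi := by
  rw [stdPhi_eq_gaussianPDFReal]
  exact ProbabilityTheory.integrable_gaussianPDFReal 0 1

lemma stdPhiCDF_neg (x : ℝ) : stdPhiCDF (-x) = 1 - stdPhiCDF x := by
  have htotal : ∫ u, stdPhi u = 1 := by
    rw [stdPhi_eq_gaussianPDFReal]
    exact ProbabilityTheory.integral_gaussianPDFReal_eq_one 0 one_ne_zero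
  have hadd := intervalIntegral.integral_Iic_add_Ioi (b := x)
    integrable_stdPhi.integrableOn integrable_stdPhi.integrableOn
  have hneg := integral_comp_neg_Iic (-x) stdPhi
  have heven (u : ℝ) : stdPhi (-u) = stdPhi u := by simp [stdPhi]
  simp only [heven, neg_neg] at hneg
  unfold stdPhiCDF
  linarith

/-- The Gaussian tail product is bounded below by a Gaussian. -/
lemma exp_le_four_mul_stdPhiCDF_mul {x : ℝ} (hx : 0 ≤ x) :
    Real.exp (-(2 / Real.pi) * x ^ 2) ≤ 4 * (stdPhiCDF x * (1 - stdPhiCDF x)) := by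
  have hpi := Real.pi_pos
  have hdiff : 2 * stdPhiCDF x - 1 =
      (Real.sqrt (2 * Real.pi))⁻¹ * ∫ u in (-x)..x, Real.exp (-(u ^ 2) / 2) := by
    have h := intervalIntegral.integral_Iic_sub_Iic (a := -x) (b := x)
      integrable_stdPhi.integrableOn integrable_stdPhi.integrableOn
    have hneg := stdPhiCDF_neg x
    rw [← intervalIntegral.integral_const_mul]
    change stdPhiCDF x - stdPhiCDF (-x) = _ at h
    change _ = ∫ u in (-x)..x, stdPhi u
    linarith
  have hsq : (2 * stdPhiCDF x - 1) ^ 2 ≤ 1 - Real.exp (-(2 / Real.pi) * x ^ 2) := by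
    rw [hdiff, mul_pow, inv_pow, Real.sq_sqrt (by positivity), inv_mul_le_iff₀ (by positivity)]
    exact sq_integral_exp_neg_sq_le hx
  linarith

/-- Bound on the standard-normal Fisher information function:
φ(x)² / (Φ(x)(1 − Φ(x))) ≤ (2/π)·exp(−(1 − 2/π)x²). -/
theorem gBar_le_exp_bound (x : ℝ) :
    (stdPhi x) ^ 2 / (stdPhiCDF x * (1 - stdPhiCDF x)) ≤
      (2 / Real.pi) * Real.exp (-(1 - 2 / Real.pi) * x ^ 2) := by
  have hpi := Real.pi_pos
  have hlow : Real.exp (-(2 / Real.pi) * x ^ 2) ≤ 4 * (stdPhiCDF x * (1 - stdPhiCDF x)) := by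
    rcases le_total 0 x with hx | hx
    · exact exp_le_four_mul_stdPhiCDF_mul hx
    · have h := exp_le_four_mul_stdPhiCDF_mul (neg_nonneg.2 hx)
      rw [stdPhiCDF_neg, neg_sq] at h
      linarith
  have hpos : 0 < stdPhiCDF x * (1 - stdPhiCDF x) := by
    linarith [Real.exp_pos (-(2 / Real.pi) * x ^ 2)]
  have hphi : stdPhi x ^ 2 = (2 / Real.pi) * Real.exp (-(1 - 2 / Real.pi) * x ^ 2) *
      (Real.exp (-(2 / Real.pi) * x ^ 2) / 4) := by
    have hexp : Real.exp (-(x ^ 2) / 2) ^ 2 =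
        Real.exp (-(1 - 2 / Real.pi) * x ^ 2) * Real.exp (-(2 / Real.pi) * x ^ 2) := by
      rw [← Real.exp_add, ← Real.exp_nat_mul]
      congr 1
      push_cast
      ring
    rw [stdPhi, mul_pow, inv_pow, Real.sq_sqrt (by positivity), hexp]
    field_simp
    ring
  rw [div_le_iff₀ hpos, hphi]
  gcongr
  linarith
end

section
/- (Lemma 2.) Let φ(t) = (1/√(2π))·exp(−t²/2) denote the standard normal PDF, and for x ≥ 0 define F̄(x) := ∫_{0}^{x} φ(u) du. Then for every x ≥ 0, F̄(x) ≤ (1/2)·√(1 − exp(−2x²/π)). -/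
/-- Differentiation under the integral sign for `∫₀¹ exp (-x²(1 + s²)/2) / (1 + s²) ds`. -/
theorem hasDerivAt_integral_exp_div_one_add_sq (x : ℝ) :
    HasDerivAt (fun y : ℝ => ∫ s in (0 : ℝ)..1, Real.exp (-(y ^ 2 * (1 + s ^ 2)) / 2) / (1 + s ^ 2))
      (∫ s in (0 : ℝ)..1, -(x * Real.exp (-(x ^ 2 * (1 + s ^ 2)) / 2))) x := by
  have hpos (s : ℝ) : 1 + s ^ 2 ≠ 0 := by positivity
  have hcont (y : ℝ) :
      Continuous fun s : ℝ => Real.exp (-(y ^ 2 * (1 + s ^ 2)) / 2) / (1 + s ^ 2) :=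
    Continuous.div (by fun_prop) (by fun_prop) hpos
  refine (intervalIntegral.hasDerivAt_integral_of_dominated_loc_of_deriv_le
    (F' := fun y s => -(y * Real.exp (-(y ^ 2 * (1 + s ^ 2)) / 2)))
    (bound := fun _ => |x| + 1) (Metric.ball_mem_nhds x one_pos)
    (.of_forall fun y => (hcont y).aestronglyMeasurable)
    ((hcont x).intervalIntegrable _ _)
    (Continuous.aestronglyMeasurable (by fun_prop)) ?_ (by simp) ?_).2
  · refine .of_forall fun s _ y hy => ?_
    have hyx : |y - x| < 1 := by simpa [Real.dist_eq] using hy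
    have hy' : |y| ≤ |x| + 1 := by linarith [abs_sub_abs_le_abs_sub y x]
    have hexp : Real.exp (-(y ^ 2 * (1 + s ^ 2)) / 2) ≤ 1 := by
      rw [Real.exp_le_one_iff]
      have : 0 ≤ y ^ 2 * (1 + s ^ 2) := by positivity
      linarith
    rw [Real.norm_eq_abs, abs_neg, abs_mul, Real.abs_exp]
    exact (mul_le_of_le_one_right (abs_nonneg y) hexp).trans hy'
  · refine .of_forall fun s _ y _ => ?_
    have h : HasDerivAt (fun y : ℝ => -(y ^ 2 * (1 + s ^ 2)) / 2) (-(y * (1 + s ^ 2))) y := by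
      refine (((hasDerivAt_pow 2 y).mul_const (1 + s ^ 2)).neg.div_const 2).congr_deriv ?_
      push_cast
      ring
    refine (h.exp.div_const (1 + s ^ 2)).congr_deriv ?_
    have := hpos s
    field_simp

/-- A closed form for the square of `∫₀ˣ exp (-t²/2) dt`. -/
theorem sq_integral_exp_neg_sq_half (x : ℝ) :
    (∫ t in (0 : ℝ)..x, Real.exp (-(t ^ 2) / 2)) ^ 2 = Real.pi / 2 -
      2 * ∫ s in (0 : ℝ)..1, Real.exp (-(x ^ 2 * (1 + s ^ 2)) / 2) / (1 + s ^ 2) := by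
  set A : ℝ → ℝ := fun x => ∫ t in (0 : ℝ)..x, Real.exp (-(t ^ 2) / 2) with hA
  set F : ℝ → ℝ := fun x =>
    ∫ s in (0 : ℝ)..1, Real.exp (-(x ^ 2 * (1 + s ^ 2)) / 2) / (1 + s ^ 2) with hF
  have hderivA (y : ℝ) : HasDerivAt A (Real.exp (-(y ^ 2) / 2)) y :=
    intervalIntegral.integral_hasDerivAt_right
      (Continuous.intervalIntegrable (by fun_prop) _ _)
      (Continuous.stronglyMeasurableAtFilter (by fun_prop) _ _)
      (Continuous.continuousAt (by fun_prop))
  have hderivF (y : ℝ) : HasDerivAt F (-(Real.exp (-(y ^ 2) / 2) * A y)) y := by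
    refine (hasDerivAt_integral_exp_div_one_add_sq y).congr_deriv (Eq.symm ?_)
    have h := intervalIntegral.mul_integral_comp_mul_left
      (f := fun t : ℝ => Real.exp (-(t ^ 2) / 2)) (a := 0) (b := 1) y
    rw [mul_zero, mul_one] at h
    change -(Real.exp (-(y ^ 2) / 2) * ∫ t in (0 : ℝ)..y, Real.exp (-(t ^ 2) / 2)) = _
    rw [← h, ← mul_assoc, ← intervalIntegral.integral_const_mul,
      ← intervalIntegral.integral_neg]
    refine intervalIntegral.integral_congr fun s _ => ?_
    have : -(y ^ 2 * (1 + s ^ 2)) / 2 = -(y ^ 2) / 2 + -((y * s) ^ 2) / 2 := by ring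
    simp only [this, Real.exp_add]
    ring
  have hderiv (y : ℝ) : HasDerivAt (fun y => A y ^ 2 + 2 * F y) 0 y := by
    refine (((hderivA y).pow 2).add ((hderivF y).const_mul 2)).congr_deriv ?_
    push_cast
    ring
  have hconst := is_const_of_deriv_eq_zero (fun y => (hderiv y).differentiableAt)
    (fun y => (hderiv y).deriv) x 0
  have hA0 : A 0 = 0 := by simp [hA]
  have hF0 : F 0 = Real.pi / 4 := by simp [hF]
  simp only [hA0, hF0] at hconst
  change A x ^ 2 = Real.pi / 2 - 2 * F x
  linarith

/-- Jensen's inequality for `exp` and the probability density `(4/π) / (1 + s²)` on `[0, 1]`. -/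
theorem exp_le_integral_exp_div_one_add_sq (x : ℝ) :
    Real.pi / 4 * Real.exp (-(2 * x ^ 2) / Real.pi) ≤
      ∫ s in (0 : ℝ)..1, Real.exp (-(x ^ 2 * (1 + s ^ 2)) / 2) / (1 + s ^ 2) := by
  have hpos (s : ℝ) : 1 + s ^ 2 ≠ 0 := by positivity
  set c : ℝ := -(2 * x ^ 2) / Real.pi with hc
  have hinv : Continuous fun s : ℝ => (1 + s ^ 2)⁻¹ := Continuous.inv₀ (by fun_prop) hpos
  have htangent : ∫ s in (0 : ℝ)..1, Real.exp c * ((1 - c) * (1 + s ^ 2)⁻¹ - x ^ 2 / 2) =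
      Real.pi / 4 * Real.exp c := by
    rw [intervalIntegral.integral_const_mul, intervalIntegral.integral_sub
      ((hinv.const_mul _).intervalIntegrable _ _) (by simp),
      intervalIntegral.integral_const_mul, integral_inv_one_add_sq]
    simp only [Real.arctan_one, Real.arctan_zero, intervalIntegral.integral_const, smul_eq_mul, hc]
    have := Real.pi_ne_zero
    field_simp
    ring
  rw [← htangent]
  refine intervalIntegral.integral_mono_on zero_le_one
    (Continuous.intervalIntegrable (by fun_prop) _ _)
    (Continuous.intervalIntegrable (Continuous.div (by fun_prop) (by fun_prop) hpos) _ _)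
    fun s _ => ?_
  have hle := Real.add_one_le_exp (-(x ^ 2 * (1 + s ^ 2)) / 2 - c)
  have hexp : Real.exp (-(x ^ 2 * (1 + s ^ 2)) / 2) =
      Real.exp c * Real.exp (-(x ^ 2 * (1 + s ^ 2)) / 2 - c) := by
    rw [← Real.exp_add]
    ring_nf
  have hs := hpos s
  rw [hexp, mul_div_assoc]
  refine mul_le_mul_of_nonneg_left ?_ (Real.exp_pos c).le
  rw [le_div_iff₀ (by positivity)]
  calc ((1 - c) * (1 + s ^ 2)⁻¹ - x ^ 2 / 2) * (1 + s ^ 2)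
      = -(x ^ 2 * (1 + s ^ 2)) / 2 - c + 1 := by field_simp; ring
    _ ≤ _ := hle

/-- Lemma 2: for x ≥ 0, ∫₀ˣ φ(u) du ≤ (1/2)·√(1 − exp(−2x²/π)). -/
theorem gauss_integral_upper_bound (x : ℝ) (hx : 0 ≤ x) :
    (∫ u in (0 : ℝ)..x, stdPhi u) ≤ (1 / 2) * Real.sqrt (1 - Real.exp (-(2 * x ^ 2) / Real.pi)) := by
  have hsq := sq_integral_exp_neg_sq_half x
  have hjensen := exp_le_integral_exp_div_one_add_sq x
  have hpi := Real.pi_pos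
  have hbound : 2 * (∫ u in (0 : ℝ)..x, stdPhi u) ≤
      Real.sqrt (1 - Real.exp (-(2 * x ^ 2) / Real.pi)) := by
    refine Real.le_sqrt_of_sq_le ?_
    simp only [stdPhi]
    rw [intervalIntegral.integral_const_mul, mul_pow, mul_pow, inv_pow,
      Real.sq_sqrt (by positivity), hsq]
    have hscale := mul_le_mul_of_nonneg_left hjensen (by positivity : 0 ≤ 4 / Real.pi)
    rw [← mul_assoc, show 4 / Real.pi * (Real.pi / 4) = 1 by field_simp, one_mul] at hscale
    calc _ = 1 - 4 / Real.pi *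
          ∫ s in (0 : ℝ)..1, Real.exp (-(x ^ 2 * (1 + s ^ 2)) / 2) / (1 + s ^ 2) := by
          generalize (∫ s in (0 : ℝ)..1, Real.exp (-(x ^ 2 * (1 + s ^ 2)) / 2) / (1 + s ^ 2)) = I
          field_simp
          ring
      _ ≤ _ := by linarith
  linarith
end

section
/- (Theorem 2, lower bound.) Let K, L, M ≥ 1 be integers, σ > 0, P > 0, and let X ∈ ℂ^{K×L} satisfy Re(tr(X·Xᴴ)) ≤ P, where Xᴴ denotes the conjugate transpose. Assume that the matrix ÃᵀÃ ∈ ℝ^{2K×2K} is positive definite. Then with A = I_M ⊗ Ã, (πσ²/2)·tr((AᵀA)⁻¹) ≥ πσ²·M·K²/P. -/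
open Matrix Kronecker

/-- The real matrix Ã associated with X ∈ ℂ^{K×L}: the transpose of the block matrix
[[Re X, Im X], [−Im X, Re X]]. -/
noncomputable def Atilde {K L : ℕ} (X : Matrix (Fin K) (Fin L) ℂ) :
    Matrix (Fin L ⊕ Fin L) (Fin K ⊕ Fin K) ℝ :=
  Matrix.transpose (Matrix.fromBlocks (X.map Complex.re) (X.map Complex.im)
    (-(X.map Complex.im)) (X.map Complex.re))

/-- For a real positive definite matrix `G` of size `n`, one has `n² ≤ tr G * tr G⁻¹`. -/
theorem Matrix.PosDef.sq_card_le_trace_mul_trace_inv {n : Type*} [Fintype n] [DecidableEq n]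
    {G : Matrix n n ℝ} (hG : G.PosDef) :
    (Fintype.card n : ℝ) ^ 2 ≤ G.trace * (G⁻¹).trace := by
  have hdet : IsUnit G.det := (Matrix.isUnit_iff_isUnit_det G).mp hG.isUnit
  have hquad (t : ℝ) :
      0 ≤ G.trace * (t * t) + (-2 * (Fintype.card n : ℝ)) * t + (G⁻¹).trace := by
    have hself : (1 - t • G)ᴴ = 1 - t • G := by
      rw [conjTranspose_sub, conjTranspose_smul, hG.isHermitian.eq]
      simp
    have h := (hG.inv.posSemidef.mul_mul_conjTranspose_same (1 - t • G)).trace_nonneg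
    have hexp : (1 - t • G) * G⁻¹ * (1 - t • G)ᴴ =
        G⁻¹ - (2 * t) • (1 : Matrix n n ℝ) + (t * t) • G := by
      rw [hself]
      simp only [sub_mul, mul_sub, one_mul, mul_one, smul_mul_assoc, mul_smul_comm,
        Matrix.mul_nonsing_inv G hdet, Matrix.nonsing_inv_mul G hdet]
      module
    rw [hexp, trace_add, trace_sub, trace_smul, trace_smul, trace_one] at h
    simp only [smul_eq_mul] at h
    linarith
  have hdiscrim := discrim_le_zero hquad
  rw [discrim] at hdiscrim
  linarith

theorem trace_transpose_mul_Atilde {K L : ℕ} (X : Matrix (Fin K) (Fin L) ℂ) :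
    ((Atilde X).transpose * Atilde X).trace = 2 * ((X * X.conjTranspose).trace).re := by
  simp only [Atilde, transpose_transpose, fromBlocks_transpose, fromBlocks_multiply]
  simp only [trace, diag_apply, Fintype.sum_sum_type, fromBlocks_apply₁₁, fromBlocks_apply₂₂,
    Matrix.add_apply, mul_apply, map_apply, transpose_apply, Matrix.neg_apply,
    conjTranspose_apply, Complex.re_sum, RCLike.star_def, Complex.mul_re, Complex.conj_re,
    Complex.conj_im, Finset.mul_sum, ← Finset.sum_add_distrib]
  exact Finset.sum_congr rfl fun i _ => Finset.sum_congr rfl fun j _ => by ring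

theorem trace_inv_one_kronecker {m l n : Type*} [Fintype m] [DecidableEq m] [Fintype l]
    [Fintype n] [DecidableEq n] (B : Matrix l n ℝ) :
    (((((1 : Matrix m m ℝ) ⊗ₖ B).transpose * ((1 : Matrix m m ℝ) ⊗ₖ B))⁻¹).trace) =
      Fintype.card m * ((B.transpose * B)⁻¹).trace := by
  rw [← kroneckerMap_transpose, ← mul_kronecker_mul, transpose_one, one_mul, inv_kronecker,
    inv_one, trace_kronecker, trace_one]

/-- Theorem 2 (lower bound): if Re(tr(X·Xᴴ)) ≤ P and ÃᵀÃ is positive definite, then with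
A = I_M ⊗ Ã one has (πσ²/2)·tr((AᵀA)⁻¹) ≥ πσ²MK²/P. -/
theorem optimal_pilot_lower_bound {K L M : ℕ} (hK : 1 ≤ K) (hL : 1 ≤ L) (hM : 1 ≤ M)
    (σ P : ℝ) (hσ : 0 < σ) (hP : 0 < P)
    (X : Matrix (Fin K) (Fin L) ℂ)
    (hpow : ((X * X.conjTranspose).trace).re ≤ P)
    (hpd : ((Atilde X).transpose * Atilde X).PosDef) :
    Real.pi * σ ^ 2 * M * K ^ 2 / P ≤
      (Real.pi * σ ^ 2 / 2) *
        ((((1 : Matrix (Fin M) (Fin M) ℝ) ⊗ₖ Atilde X).transpose *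
          ((1 : Matrix (Fin M) (Fin M) ℝ) ⊗ₖ Atilde X))⁻¹).trace := by
  have htrace : ((Atilde X).transpose * Atilde X).trace ≤ 2 * P := by
    rw [trace_transpose_mul_Atilde]
    linarith
  have hcard := hpd.sq_card_le_trace_mul_trace_inv
  have hinv := hpd.inv.posSemidef.trace_nonneg
  rw [trace_inv_one_kronecker, Fintype.card_fin]
  set T := (((Atilde X).transpose * Atilde X)⁻¹).trace
  simp only [Fintype.card_sum, Fintype.card_fin, Nat.cast_add] at hcard
  have hT : 2 * (K : ℝ) ^ 2 ≤ T * P := by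
    linarith [mul_le_mul_of_nonneg_right htrace hinv]
  rw [div_le_iff₀ hP]
  have hc : 0 ≤ Real.pi * σ ^ 2 / 2 * M := by positivity
  linarith [mul_le_mul_of_nonneg_left hT hc]
end
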